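/- For every ε > 0 there exists t₀ such that for every integer t ≥ t₀ and every integer n with t ≤ n < 4t/3, every graph on n vertices with no K_t-minor has at most 2^{4t − 3n + 2(n−t)·log₂3 + εt} cliques. -/

import Mathlib

/-- `H` is a minor of `G`: there are disjoint nonempty connected branch sets in `G`,
one for each vertex of `H`, with an edge of `G` between the branch sets of any two
vertices adjacent in `H`. -/
def SimpleGraph.IsMinor {W V : Type*} (H : SimpleGraph W) (G : SimpleGraph V) : Prop :=
  ∃ f : W → Set V,
    (∀ w, (f w).Nonempty) ∧
    (∀ w, (G.induce (f w)).Connected) ∧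
    (Pairwise fun w₁ w₂ => Disjoint (f w₁) (f w₂)) ∧
    ∀ ⦃w₁ w₂⦄, H.Adj w₁ w₂ → ∃ v₁ ∈ f w₁, ∃ v₂ ∈ f w₂, G.Adj v₁ v₂

/-- The number of cliques (vertex subsets inducing complete subgraphs, including `∅`). -/
noncomputable def SimpleGraph.cliqueCount {V : Type*} [Fintype V] (G : SimpleGraph V) : ℕ :=
  Nat.card {s : Finset V // G.IsClique (s : Set V)}

/-- The number of cliques containing a given vertex. -/
noncomputable def SimpleGraph.cliqueCountOn {V : Type*} [Fintype V] (G : SimpleGraph V)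
    (v : V) : ℕ :=
  Nat.card {s : Finset V // G.IsClique (s : Set V) ∧ v ∈ s}

/-- The Hadwiger number: the largest `t` such that `K_t` is a minor of `G`. -/
noncomputable def SimpleGraph.hadwigerNumber {V : Type*} [Fintype V] (G : SimpleGraph V) : ℕ :=
  sSup {t | (completeGraph (Fin t)).IsMinor G}

/-- The matching number: the maximum number of edges of a matching in `G`. -/
noncomputable def SimpleGraph.matchingNumber {V : Type*} [Fintype V] (G : SimpleGraph V) : ℕ :=
  sSup {k | ∃ M : G.Subgraph, M.IsMatching ∧ M.edgeSet.ncard = k}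

/-- The cliques of `G` contained in the vertex set `S`. -/
noncomputable def SimpleGraph.cliquesIn {V : Type*} (G : SimpleGraph V)
    (S : Finset V) : Finset (Finset V) :=
  open Classical in S.powerset.filter fun s => G.IsClique (s : Set V)

namespace SimpleGraph

open Finset

variable {V : Type*} {G : SimpleGraph V}

theorem mem_cliquesIn {S s : Finset V} :
    s ∈ G.cliquesIn S ↔ s ⊆ S ∧ G.IsClique (s : Set V) := by
  simp [cliquesIn]

theorem cliqueCount_eq_card_cliquesIn_univ [Fintype V] (G : SimpleGraph V) :
    G.cliqueCount = #(G.cliquesIn univ) :=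
  Nat.subtype_card _ fun s => by simp [mem_cliquesIn]

/-- A family of branch sets of a complete minor: nonempty connected sets which are pairwise
disjoint and joined by edges. -/
structure IsCompleteMinorModel (G : SimpleGraph V) (F : Finset (Finset V)) : Prop where
  connected : ∀ s ∈ F, (G.induce (s : Set V)).Connected
  disjoint : ∀ s ∈ F, ∀ s' ∈ F, s ≠ s' → Disjoint s s'
  adj : ∀ s ∈ F, ∀ s' ∈ F, s ≠ s' → ∃ u ∈ s, ∃ v ∈ s', G.Adj u v

theorem IsCompleteMinorModel.isMinor {F : Finset (Finset V)} (hF : G.IsCompleteMinorModel F)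
    {t : ℕ} (ht : t ≤ #F) : (completeGraph (Fin t)).IsMinor G := by
  let e : Fin t ↪ F := (Fin.castLEEmb ht).trans F.equivFin.symm.toEmbedding
  have hne : ∀ i j, i ≠ j → (e i : Finset V) ≠ e j := fun i j hij h =>
    hij (e.injective (Subtype.ext h))
  refine ⟨fun i => ((e i : Finset V) : Set V), fun i => ?_, fun i => hF.connected _ (e i).2,
    fun i j hij => ?_, fun i j hij => ?_⟩
  · exact Set.nonempty_coe_sort.1 (hF.connected _ (e i).2).nonempty
  · exact disjoint_coe.2 (hF.disjoint _ (e i).2 _ (e j).2 (hne i j hij))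
  · exact hF.adj _ (e i).2 _ (e j).2 (hne i j hij.ne)

variable [DecidableEq V]

/-- The cliques in `S` either avoid `v`, or consist of `v` and a clique of neighbours of `v`. -/
theorem card_cliquesIn_le_erase_add [DecidableRel G.Adj] (S : Finset V) (v : V) :
    #(G.cliquesIn S) ≤ #(G.cliquesIn (S.erase v)) + #(G.cliquesIn (S.filter (G.Adj v))) := by
  have hsub : G.cliquesIn S ⊆
      G.cliquesIn (S.erase v) ∪ (G.cliquesIn (S.filter (G.Adj v))).image (insert v) := by
    intro s hs
    rw [mem_cliquesIn] at hs
    rw [mem_union, mem_image]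
    by_cases hv : v ∈ s
    · refine Or.inr ⟨s.erase v, ?_, insert_erase hv⟩
      rw [mem_cliquesIn]
      refine ⟨fun x hx => ?_, hs.2.subset (by simp)⟩
      rw [mem_erase] at hx
      exact mem_filter.2 ⟨hs.1 hx.2, hs.2 hv hx.2 hx.1.symm⟩
    · refine Or.inl (mem_cliquesIn.2 ⟨fun x hx => mem_erase.2 ⟨?_, hs.1 hx⟩, hs.2⟩)
      rintro rfl
      exact hv hx
  calc #(G.cliquesIn S) ≤ _ := card_le_card hsub
    _ ≤ _ := card_union_le _ _
    _ ≤ _ := Nat.add_le_add_left card_image_le _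

/-- If all cliques in `S` have at most `r` vertices, then `S` contains at most
`(4/3)^r (3/2)^|S|` cliques. -/
theorem card_cliquesIn_le_of_forall_card_le [DecidableRel G.Adj] (S : Finset V) (r : ℕ)
    (hr : ∀ s ⊆ S, G.IsClique (s : Set V) → #s ≤ r) :
    (#(G.cliquesIn S) : ℝ) ≤ (4 / 3) ^ r * (3 / 2) ^ #S := by
  induction hm : #S using Nat.strong_induction_on generalizing S r with
  | _ m ih =>
  by_cases hS : G.IsClique (S : Set V)
  · have hcard : #(G.cliquesIn S) ≤ 2 ^ m := by
      rw [← hm, ← card_powerset]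
      exact card_le_card fun s hs => mem_powerset.2 (mem_cliquesIn.1 hs).1
    calc (#(G.cliquesIn S) : ℝ) ≤ 2 ^ m := mod_cast hcard
      _ = (4 / 3) ^ m * (3 / 2) ^ m := by rw [← mul_pow]; norm_num
      _ ≤ _ := by
        have := hr S subset_rfl hS
        gcongr
        · norm_num
        · omega
  · simp only [isClique_iff, Set.Pairwise, not_forall, mem_coe] at hS
    obtain ⟨v, hv, w, hw, hne, hadj⟩ := hS
    obtain ⟨r, rfl⟩ : ∃ k, r = k + 1 := by
      have := hr {v} (by simpa using hv) (by simp)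
      exact Nat.exists_eq_add_of_le' (by simpa using this)
    have hle : #(S.filter (G.Adj v)) + 2 ≤ m := by
      have hsub : S.filter (G.Adj v) ⊆ (S.erase v).erase w := by
        intro x hx
        rw [mem_filter] at hx
        refine mem_erase.2 ⟨?_, mem_erase.2 ⟨hx.2.ne', hx.1⟩⟩
        rintro rfl
        exact hadj hx.2
      have := card_le_card hsub
      rw [card_erase_of_mem (mem_erase.2 ⟨hne.symm, hw⟩), card_erase_of_mem hv] at this
      have : 1 < #S := one_lt_card.2 ⟨v, hv, w, hw, hne⟩
      omega
    obtain ⟨m, rfl⟩ : ∃ k, m = k + 2 := Nat.exists_eq_add_of_le' (by omega)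
    have herase := ih (m + 1) (by omega) (S.erase v) (r + 1)
      (fun s hs => hr s (hs.trans (erase_subset _ _))) (by rw [card_erase_of_mem hv]; omega)
    have hnbr := ih _ (by omega) (S.filter (G.Adj v)) r (fun s hs hc => by
      have hvs : v ∉ s := fun h => by simpa using hs h
      have := hr (insert v s) (insert_subset hv (hs.trans (filter_subset _ _))) (by
        rw [coe_insert, isClique_insert]
        exact ⟨hc, fun b hb _ => (mem_filter.1 (hs hb)).2⟩)
      rw [card_insert_of_notMem hvs] at this
      omega) rfl
    have hmono : (3 / 2 : ℝ) ^ #(S.filter (G.Adj v)) ≤ (3 / 2) ^ m :=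
      pow_le_pow_right₀ (by norm_num) (by omega)
    calc (#(G.cliquesIn S) : ℝ)
        ≤ #(G.cliquesIn (S.erase v)) + #(G.cliquesIn (S.filter (G.Adj v))) :=
          mod_cast card_cliquesIn_le_erase_add S v
      _ ≤ (4 / 3) ^ (r + 1) * (3 / 2) ^ (m + 1) + (4 / 3) ^ r * (3 / 2) ^ m := by
        refine add_le_add herase (hnbr.trans ?_)
        gcongr
      _ = _ := by ring

/-- Reduction to vertex sets in which every vertex has fewer than `D` non-neighbours, at the cost
of a factor `c ^ |S|`. -/
theorem card_cliquesIn_le_mul_pow [DecidableRel G.Adj] {D : ℕ} {c M : ℝ} (hc : 1 ≤ c)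
    (hD : c ^ D + 1 ≤ c ^ (D + 1)) (hM : 0 ≤ M) (S : Finset V)
    (h : ∀ S' ⊆ S, (∀ v ∈ S', #(S'.filter fun u => u ≠ v ∧ ¬ G.Adj v u) < D) →
      (#(G.cliquesIn S') : ℝ) ≤ M) :
    (#(G.cliquesIn S) : ℝ) ≤ M * c ^ #S := by
  induction hm : #S using Nat.strong_induction_on generalizing S with
  | _ m ih =>
  by_cases hS : ∀ v ∈ S, #(S.filter fun u => u ≠ v ∧ ¬ G.Adj v u) < D
  · exact (h S subset_rfl hS).trans (le_mul_of_one_le_right hM (one_le_pow₀ hc))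
  · push Not at hS
    obtain ⟨v, hv, hdeg⟩ := hS
    have hle : #(S.filter (G.Adj v)) + (D + 1) ≤ m := by
      have hdisj : Disjoint (S.filter (G.Adj v)) (S.filter fun u => u ≠ v ∧ ¬ G.Adj v u) :=
        disjoint_filter.2 fun x _ hx hx' => hx'.2 hx
      have hsub : S.filter (G.Adj v) ∪ (S.filter fun u => u ≠ v ∧ ¬ G.Adj v u) ⊆ S.erase v := by
        intro x hx
        rw [mem_union, mem_filter, mem_filter] at hx
        rcases hx with hx | hx
        · exact mem_erase.2 ⟨hx.2.ne', hx.1⟩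
        · exact mem_erase.2 ⟨hx.2.1, hx.1⟩
      have := card_le_card hsub
      rw [card_union_of_disjoint hdisj, card_erase_of_mem hv] at this
      have := card_pos.2 ⟨v, hv⟩
      omega
    obtain ⟨m, rfl⟩ : ∃ k, m = k + (D + 1) := Nat.exists_eq_add_of_le' (by omega)
    have herase := ih (m + D) (by omega) (S.erase v)
      (fun s hs => h s (hs.trans (erase_subset _ _))) (by rw [card_erase_of_mem hv]; omega)
    have hnbr := ih _ (by omega) (S.filter (G.Adj v))
      (fun s hs => h s (hs.trans (filter_subset _ _))) rfl
    have hmono : c ^ #(S.filter (G.Adj v)) ≤ c ^ m := pow_le_pow_right₀ hc (by omega)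
    calc (#(G.cliquesIn S) : ℝ)
        ≤ #(G.cliquesIn (S.erase v)) + #(G.cliquesIn (S.filter (G.Adj v))) :=
          mod_cast card_cliquesIn_le_erase_add S v
      _ ≤ M * c ^ (m + D) + M * c ^ m := by
        refine add_le_add herase (hnbr.trans ?_)
        gcongr
      _ = M * c ^ m * (c ^ D + 1) := by ring
      _ ≤ M * c ^ m * c ^ (D + 1) := by gcongr
      _ = _ := by ring

/-- A large subset of a set with few non-adjacencies contains an edge dominating the set. -/
theorem exists_adj_dominating [DecidableRel G.Adj] {D : ℕ} {S R : Finset V}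
    (hS : ∀ v ∈ S, #(S.filter fun u => u ≠ v ∧ ¬ G.Adj v u) < D) (hRS : R ⊆ S)
    (hR : 1 + D + D * D < #R) :
    ∃ u ∈ R, ∃ v ∈ R, G.Adj u v ∧ ∀ x ∈ S, x ≠ u → x ≠ v → G.Adj u x ∨ G.Adj v x := by
  obtain ⟨u, hu⟩ : R.Nonempty := card_pos.1 (by omega)
  let N : V → Finset V := fun v => S.filter fun u => u ≠ v ∧ ¬ G.Adj v u
  have hcard : #({u} ∪ N u ∪ (N u).biUnion N) ≤ 1 + D + D * D := by
    have hbi : #((N u).biUnion N) ≤ #(N u) * D :=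
      card_biUnion_le_card_mul _ _ _ fun x hx => (hS x (mem_filter.1 hx).1).le
    have hNu : #(N u) ≤ D := (hS u (hRS hu)).le
    calc #({u} ∪ N u ∪ (N u).biUnion N) ≤ #({u} ∪ N u) + #((N u).biUnion N) := card_union_le _ _
      _ ≤ (#{u} + #(N u)) + #(N u) * D := add_le_add (card_union_le _ _) hbi
      _ ≤ 1 + D + D * D := by rw [card_singleton]; gcongr
  obtain ⟨v, hv, hvN⟩ := exists_mem_notMem_of_card_lt_card (hcard.trans_lt hR)
  simp only [mem_union, mem_singleton, mem_biUnion, not_or, not_exists, not_and, N, mem_filter,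
    not_not] at hvN
  obtain ⟨⟨hvu, hadj⟩, hcom⟩ := hvN
  refine ⟨u, hu, v, hv, hadj (hRS hv) hvu, fun x hx hxu hxv => ?_⟩
  by_cases hux : G.Adj u x
  · exact Or.inl hux
  · exact Or.inr (hcom x ⟨hx, hxu, hux⟩ (hRS hv) hxv.symm).symm

/-- The vertices of a clique are the branch sets of a complete minor. -/
theorem IsClique.isCompleteMinorModel {I : Finset V} (hI : G.IsClique (I : Set V)) :
    G.IsCompleteMinorModel (I.image singleton) where
  connected := by
    intro s hs
    obtain ⟨x, -, rfl⟩ := mem_image.1 hs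
    rw [coe_singleton, induce_singleton_eq_top]
    exact connected_top
  disjoint := by
    intro s hs s' hs' hne
    obtain ⟨x, -, rfl⟩ := mem_image.1 hs
    obtain ⟨y, -, rfl⟩ := mem_image.1 hs'
    rw [disjoint_singleton]
    rintro rfl
    exact hne rfl
  adj := by
    intro s hs s' hs' hne
    obtain ⟨x, hx, rfl⟩ := mem_image.1 hs
    obtain ⟨y, hy, rfl⟩ := mem_image.1 hs'
    refine ⟨x, by simp, y, by simp, hI hx hy ?_⟩
    rintro rfl
    exact hne rfl

/-- An edge dominating all branch sets of a complete minor is a further branch set. -/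
theorem IsCompleteMinorModel.insert_pair {F : Finset (Finset V)} (hF : G.IsCompleteMinorModel F)
    {u v : V} (huv : G.Adj u v) (hdisj : ∀ s ∈ F, u ∉ s ∧ v ∉ s)
    (hdom : ∀ s ∈ F, ∀ x ∈ s, G.Adj u x ∨ G.Adj v x) :
    G.IsCompleteMinorModel (insert {u, v} F) := by
  have hadj : ∀ s ∈ F, ∃ y ∈ ({u, v} : Finset V), ∃ x ∈ s, G.Adj y x := by
    intro s hs
    obtain ⟨x, hx⟩ := (hF.connected s hs).nonempty
    rcases hdom s hs x hx with h | h
    · exact ⟨u, by simp, x, hx, h⟩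
    · exact ⟨v, by simp, x, hx, h⟩
  have hdisj' : ∀ s ∈ F, Disjoint {u, v} s := by
    intro s hs
    simpa [disjoint_insert_left] using hdisj s hs
  refine ⟨?_, ?_, ?_⟩
  · intro s hs
    rcases mem_insert.1 hs with rfl | hs
    · rw [coe_pair]
      exact induce_pair_connected_of_adj huv
    · exact hF.connected s hs
  · intro s hs s' hs' hne
    rcases mem_insert.1 hs with rfl | hs <;> rcases mem_insert.1 hs' with rfl | hs'
    · exact absurd rfl hne
    · exact hdisj' s' hs'
    · exact (hdisj' s hs).symm
    · exact hF.disjoint s hs s' hs' hne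
  · intro s hs s' hs' hne
    rcases mem_insert.1 hs with rfl | hs <;> rcases mem_insert.1 hs' with rfl | hs'
    · exact absurd rfl hne
    · exact hadj s' hs'
    · obtain ⟨y, hy, x, hx, h⟩ := hadj s hs
      exact ⟨x, hx, y, hy, h.symm⟩
    · exact hF.adj s hs s' hs' hne

/-- In a set with few non-adjacencies, a clique extends to a complete minor by pairing up almost
all remaining vertices. -/
theorem exists_isCompleteMinorModel [DecidableRel G.Adj] {D : ℕ} {S I R : Finset V}
    (hS : ∀ v ∈ S, #(S.filter fun u => u ≠ v ∧ ¬ G.Adj v u) < D) (hI : G.IsClique (I : Set V))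
    (hIS : I ⊆ S) (hRS : R ⊆ S) (hIR : Disjoint I R) (k : ℕ)
    (hk : 2 * k ≤ #R - (1 + D + D * D)) :
    ∃ F, G.IsCompleteMinorModel F ∧ #F = #I + k ∧ ∀ s ∈ F, s ⊆ I ∪ R := by
  induction k generalizing R with
  | zero =>
    refine ⟨_, hI.isCompleteMinorModel, card_image_of_injective _ singleton_injective, ?_⟩
    intro s hs
    obtain ⟨x, hx, rfl⟩ := mem_image.1 hs
    simp [hx]
  | succ k ih =>
    obtain ⟨u, hu, v, hv, huv, hdom⟩ := exists_adj_dominating hS hRS (by omega)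
    have hsub : (R.erase u).erase v ⊆ R := (erase_subset _ _).trans (erase_subset _ _)
    obtain ⟨F, hF, hcard, hFsub⟩ := ih (R := (R.erase u).erase v) (hsub.trans hRS)
      (disjoint_of_subset_right hsub hIR) (by
        rw [card_erase_of_mem (mem_erase.2 ⟨huv.ne', hv⟩), card_erase_of_mem hu]
        omega)
    have hnot : ∀ s ∈ F, u ∉ s ∧ v ∉ s := by
      refine fun s hs => ⟨fun h => ?_, fun h => ?_⟩
      · have := hFsub s hs h
        simp [disjoint_right.1 hIR hu] at this
      · have := hFsub s hs h
        simp [disjoint_right.1 hIR hv] at this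
    refine ⟨_, hF.insert_pair huv hnot fun s hs x hx => ?_, ?_, ?_⟩
    · refine hdom x ?_ ?_ ?_
      · exact union_subset hIS (hsub.trans hRS) (hFsub s hs hx)
      · rintro rfl
        exact (hnot s hs).1 hx
      · rintro rfl
        exact (hnot s hs).2 hx
    · rw [card_insert_of_notMem fun h => (hnot _ h).1 (by simp), hcard, add_assoc]
    · intro s hs
      rcases mem_insert.1 hs with rfl | hs
      · simp [insert_subset_iff, hu, hv]
      · exact (hFsub s hs).trans (union_subset_union_right hsub)

/-- Without a `K_t`-minor, cliques in a set with few non-adjacencies are small. -/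
theorem card_add_card_le_of_not_isMinor [DecidableRel G.Adj] {t D : ℕ} {S I : Finset V}
    (hG : ¬ (completeGraph (Fin t)).IsMinor G)
    (hS : ∀ v ∈ S, #(S.filter fun u => u ≠ v ∧ ¬ G.Adj v u) < D) (hI : G.IsClique (I : Set V))
    (hIS : I ⊆ S) : #I + #S ≤ 2 * t + (1 + D + D * D) := by
  by_contra! hlt
  have hsdiff : #(S \ I) = #S - #I := card_sdiff_of_subset hIS
  obtain ⟨F, hF, hcard, -⟩ := exists_isCompleteMinorModel hS hI hIS (sdiff_subset (t := I))
    disjoint_sdiff (t - #I) (by rw [hsdiff]; omega)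
  exact hG (hF.isMinor (by omega))

/-- An explicit bound on the number of cliques of a graph without `K_t`-minor. -/
theorem cliqueCount_le_of_not_isMinor [Fintype V] {t D : ℕ} {c : ℝ} (hc : 1 ≤ c)
    (hD : c ^ D + 1 ≤ c ^ (D + 1)) (ht : Fintype.card V ≤ 2 * t)
    (hG : ¬ (completeGraph (Fin t)).IsMinor G) :
    (G.cliqueCount : ℝ) ≤
      (4 / 3) ^ (2 * t + (1 + D + D * D)) * (9 / 8) ^ Fintype.card V * c ^ Fintype.card V := by
  classical
  rw [cliqueCount_eq_card_cliquesIn_univ]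
  refine card_cliquesIn_le_mul_pow hc hD (by positivity) univ fun S _ hS => ?_
  have hle : #S ≤ Fintype.card V := card_le_univ S
  obtain ⟨r, hr⟩ : ∃ r, 2 * t + (1 + D + D * D) = r + #S :=
    Nat.exists_eq_add_of_le' (by omega)
  calc (#(G.cliquesIn S) : ℝ) ≤ (4 / 3) ^ r * (3 / 2) ^ #S :=
        card_cliquesIn_le_of_forall_card_le S r fun I hIS hI => by
          have := card_add_card_le_of_not_isMinor hG hS hI hIS
          omega
    _ = (4 / 3) ^ (2 * t + (1 + D + D * D)) * (9 / 8) ^ #S := by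
      rw [hr, pow_add, mul_assoc, ← mul_pow]
      norm_num
    _ ≤ _ := by
      gcongr
      norm_num

end SimpleGraph

theorem exists_pow_add_one_le_pow_succ {c : ℝ} (hc : 1 < c) : ∃ D : ℕ, c ^ D + 1 ≤ c ^ (D + 1) := by
  obtain ⟨D, hD⟩ := pow_unbounded_of_one_lt (c - 1)⁻¹ hc
  refine ⟨D, ?_⟩
  have h : 1 < c ^ D * (c - 1) := by rwa [← inv_lt_iff_one_lt_mul₀ (by linarith)]
  rw [pow_succ]
  linarith

theorem four_thirds_pow_mul_nine_eighths_pow (t n : ℕ) :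
    (4 / 3 : ℝ) ^ (2 * t) * (9 / 8) ^ n =
      2 ^ (4 * t - 3 * n + 2 * ((n : ℝ) - t) * Real.logb 2 3 : ℝ) := by
  have h3 : (2 : ℝ) ^ Real.logb 2 3 = 3 :=
    Real.rpow_logb (by norm_num) (by norm_num) (by norm_num)
  have h43 : (4 / 3 : ℝ) = 2 ^ (2 - Real.logb 2 3) := by
    rw [Real.rpow_sub (by norm_num), h3]
    norm_num
  have h98 : (9 / 8 : ℝ) = 2 ^ (Real.logb 2 3 + Real.logb 2 3 - 3) := by
    rw [Real.rpow_sub (by norm_num), Real.rpow_add (by norm_num), h3]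
    norm_num
  rw [h43, h98, ← Real.rpow_mul_natCast (by norm_num), ← Real.rpow_mul_natCast (by norm_num),
    ← Real.rpow_add (by norm_num)]
  congr 1
  push_cast
  ring

/-- For sufficiently large `t` and `t ≤ n < 4t/3`, every graph on `n` vertices with no
`K_t`-minor has at most `2 ^ (4t - 3n + 2(n - t) log₂ 3 + εt)` cliques. -/
theorem cliqueCount_of_no_complete_minor_few_vertices (ε : ℝ) (hε : 0 < ε) :
    ∃ t₀ : ℕ, ∀ t : ℕ, t₀ ≤ t → ∀ n : ℕ, t ≤ n → 3 * n < 4 * t →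
      ∀ (V : Type) [Fintype V], Fintype.card V = n →
        ∀ G : SimpleGraph V, ¬ (SimpleGraph.completeGraph (Fin t)).IsMinor G →
          (G.cliqueCount : ℝ) ≤
            2 ^ ((4 * t - 3 * n + 2 * ((n : ℝ) - t) * Real.logb 2 3 + ε * t : ℝ)) := by
  have hc : (1 : ℝ) < 2 ^ (ε / 4) := Real.one_lt_rpow (by norm_num) (by positivity)
  obtain ⟨D, hD⟩ := exists_pow_add_one_le_pow_succ hc
  obtain ⟨t₀, ht₀⟩ := exists_nat_ge (((1 + D + D * D : ℕ) : ℝ) / (ε / 2))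
  refine ⟨t₀, fun t ht n _ hn V _ hV G hG => ?_⟩
  classical
  have hbound := SimpleGraph.cliqueCount_le_of_not_isMinor hc.le hD
    (by omega : Fintype.card V ≤ 2 * t) hG
  rw [hV] at hbound
  have hconst : (4 / 3 : ℝ) ^ (1 + D + D * D) ≤ 2 ^ (ε / 2 * t) := by
    have htR : (t₀ : ℝ) ≤ t := mod_cast ht
    rw [div_le_iff₀ (by positivity)] at ht₀
    calc (4 / 3 : ℝ) ^ (1 + D + D * D) ≤ 2 ^ (1 + D + D * D) := by gcongr; norm_num
      _ = 2 ^ ((1 + D + D * D : ℕ) : ℝ) := (Real.rpow_natCast _ _).symm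
      _ ≤ 2 ^ (ε / 2 * t) := Real.rpow_le_rpow_of_exponent_le (by norm_num) (by nlinarith)
  have hpow : ((2 : ℝ) ^ (ε / 4)) ^ n ≤ 2 ^ (ε / 2 * t) := by
    have hnt : (n : ℝ) ≤ 2 * t := by exact_mod_cast (by omega : n ≤ 2 * t)
    rw [← Real.rpow_mul_natCast (by norm_num)]
    exact Real.rpow_le_rpow_of_exponent_le (by norm_num) (by nlinarith)
  calc (G.cliqueCount : ℝ)
      ≤ (4 / 3) ^ (2 * t + (1 + D + D * D)) * (9 / 8) ^ n * (2 ^ (ε / 4)) ^ n := hbound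
    _ = (4 / 3) ^ (2 * t) * (9 / 8) ^ n * ((4 / 3) ^ (1 + D + D * D) * (2 ^ (ε / 4)) ^ n) := by
      rw [pow_add]
      ring
    _ ≤ (4 / 3) ^ (2 * t) * (9 / 8) ^ n * (2 ^ (ε / 2 * t) * 2 ^ (ε / 2 * t)) := by gcongr
    _ = _ := by
      rw [four_thirds_pow_mul_nine_eighths_pow, ← Real.rpow_add (by norm_num),
        ← Real.rpow_add (by norm_num)]
      congr 1
      ring
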